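/- arXiv:2410.10914 — 2 statements merged into one kernel-verified Lean document; each statement's English description precedes it below -/
import Mathlib

section
/- Let v, u ∈ ℝ^G be vectors whose entries are each pairwise distinct, let ρ and π be the (unique) permutations of {1,…,G} with v_{ρ(1)} < ⋯ < v_{ρ(G)} and u_{π(1)} < ⋯ < u_{π(G)}, and let T_sort be the permutation matrix of ρ ∘ π^{-1}. Then T_sort is the unique minimizer of T ↦ ⟨−v u^⊤, T⟩ over the set Π_G of doubly stochastic matrices: for every T ∈ Π_G with T ≠ T_sort, ⟨−v u^⊤, T_sort⟩ < ⟨−v u^⊤, T⟩. -/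
open scoped BigOperators

/-- `T` is doubly stochastic: nonnegative entries, all row sums and column sums equal 1. -/
def IsDoublyStochastic {G : ℕ} (T : Matrix (Fin G) (Fin G) ℝ) : Prop :=
  (∀ i j, 0 ≤ T i j) ∧ (∀ i, ∑ j, T i j = 1) ∧ (∀ j, ∑ i, T i j = 1)

/-- `P` is a permutation matrix. -/
def IsPermMatrix {G : ℕ} (P : Matrix (Fin G) (Fin G) ℝ) : Prop :=
  ∃ σ : Equiv.Perm (Fin G), ∀ i j, P i j = if i = σ j then 1 else 0

/-- Frobenius inner product `⟨A, B⟩ = Σ_{ij} a_{ij} b_{ij}`. -/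
noncomputable def mInner {G : ℕ} (A B : Matrix (Fin G) (Fin G) ℝ) : ℝ :=
  ∑ i, ∑ j, A i j * B i j

/-- A strictly monotone permutation of `Fin n` is the identity. -/
theorem Equiv.Perm.eq_one_of_strictMono {n : ℕ} (σ : Equiv.Perm (Fin n)) (h : StrictMono σ) :
    σ = 1 := by
  have := Subsingleton.elim (h.orderIsoOfSurjective σ σ.surjective) (OrderIso.refl _)
  ext i
  simpa using congrArg Fin.val (DFunLike.congr_fun this i)

/-- The strict rearrangement inequality for two strictly increasing sequences. -/
theorem sum_mul_comp_perm_lt_of_strictMono {n : ℕ} {a b : Fin n → ℝ} (ha : StrictMono a)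
    (hb : StrictMono b) {σ : Equiv.Perm (Fin n)} (hσ : σ ≠ 1) :
    ∑ i, a i * b (σ i) < ∑ i, a i * b i := by
  have hab : Monovary a b := ha.monotone.monovary hb.monotone
  rw [hab.sum_mul_comp_perm_lt_sum_mul_iff]
  intro hmono
  apply hσ
  have hinv : StrictMono (σ⁻¹ : Equiv.Perm (Fin n)) := by
    intro x y hxy
    have hle : a (σ⁻¹ x) ≤ a (σ⁻¹ y) := hmono (by simpa using hb hxy)
    exact (ha.le_iff_le.1 hle).lt_of_ne fun h => hxy.ne (σ⁻¹.injective h)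
  exact inv_eq_one.1 (Equiv.Perm.eq_one_of_strictMono _ hinv)

/-- For strictly increasing `a` and `b`, the identity is the unique maximizer of
`S ↦ ∑ i, ∑ j, a i * b j * S i j` over the doubly stochastic matrices. -/
theorem IsDoublyStochastic.sum_mul_lt_of_ne_one {n : ℕ} {a b : Fin n → ℝ} (ha : StrictMono a)
    (hb : StrictMono b) {S : Matrix (Fin n) (Fin n) ℝ} (hS : IsDoublyStochastic S) (hne : S ≠ 1) :
    ∑ i, ∑ j, a i * b j * S i j < ∑ i, a i * b i := by
  obtain ⟨w, hw, hw1, rfl⟩ := exists_eq_sum_perm_of_mem_doublyStochastic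
    (mem_doublyStochastic_iff_sum.2 hS)
  have hsum : ∑ i, ∑ j, a i * b j * (∑ σ, w σ • σ.permMatrix ℝ : Matrix _ _ ℝ) i j
      = ∑ σ, w σ * ∑ i, a i * b (σ i) := by
    simp only [Matrix.sum_apply, Matrix.smul_apply, Finset.mul_sum, smul_eq_mul]
    rw [Finset.sum_congr rfl fun i _ => Finset.sum_comm, Finset.sum_comm]
    refine Finset.sum_congr rfl fun σ _ => Finset.sum_congr rfl fun i _ => ?_
    simp [Equiv.Perm.permMatrix, PEquiv.toMatrix_apply, mul_comm]
  have hex : ∃ σ ≠ 1, 0 < w σ := by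
    by_contra! h
    have h0 : ∀ σ ≠ 1, w σ = 0 := fun σ hσ => (h σ hσ).antisymm (hw σ)
    apply hne
    rw [Fintype.sum_eq_single 1 h0] at hw1
    rw [Fintype.sum_eq_single 1 fun σ hσ => by rw [h0 σ hσ, zero_smul], hw1, one_smul,
      Matrix.permMatrix_one]
  obtain ⟨τ, hτ, hwτ⟩ := hex
  rw [hsum, ← one_mul (∑ i, a i * b i), ← hw1, Finset.sum_mul]
  refine Finset.sum_lt_sum (fun σ _ => ?_) ⟨τ, Finset.mem_univ _, ?_⟩
  · exact mul_le_mul_of_nonneg_left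
      (ha.monotone.monovary hb.monotone).sum_mul_comp_perm_le_sum_mul (hw σ)
  · exact mul_lt_mul_of_pos_left (sum_mul_comp_perm_lt_of_strictMono ha hb hτ) hwτ

/-- if the entries of `v` and of `u` are pairwise distinct, `ρ, π` sort them
strictly increasingly, and `T_sort` is the permutation matrix of `ρ ∘ π⁻¹`, then `T_sort`
is the unique minimizer of `T ↦ ⟨−v u^⊤, T⟩` over doubly stochastic matrices. -/
theorem stmt12 {G : ℕ} (v u : Fin G → ℝ)
    (hvinj : Function.Injective v) (huinj : Function.Injective u)
    (ρ π : Equiv.Perm (Fin G))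
    (hv : StrictMono fun i => v (ρ i)) (hu : StrictMono fun i => u (π i))
    (Tsort : Matrix (Fin G) (Fin G) ℝ)
    (hT : ∀ i j, Tsort i j = if j = (ρ * π⁻¹ : Equiv.Perm (Fin G))⁻¹ i then 1 else 0) :
    ∀ T, IsDoublyStochastic T → T ≠ Tsort →
      mInner (-(Matrix.vecMulVec v u)) Tsort < mInner (-(Matrix.vecMulVec v u)) T := by
  intro T hTds hne
  have hreindex (M : Matrix (Fin G) (Fin G) ℝ) : mInner (-(Matrix.vecMulVec v u)) M
      = -∑ i, ∑ j, v (ρ i) * u (π j) * M.submatrix ρ π i j := by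
    simp only [mInner, Matrix.neg_apply, Matrix.vecMulVec_apply, neg_mul, Finset.sum_neg_distrib,
      Matrix.submatrix_apply]
    rw [← Equiv.sum_comp ρ]
    exact congrArg _ (Finset.sum_congr rfl fun i _ => (Equiv.sum_comp π _).symm)
  have hsort : Tsort.submatrix ρ π = 1 := by
    ext i j
    simp [hT, Matrix.one_apply, eq_comm]
  have hds : IsDoublyStochastic (T.submatrix ρ π) := by
    refine ⟨fun i j => hTds.1 _ _, fun i => ?_, fun j => ?_⟩
    · exact (Equiv.sum_comp π _).trans (hTds.2.1 (ρ i))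
    · exact (Equiv.sum_comp ρ fun i => T i (π j)).trans (hTds.2.2 (π j))
  have hne' : T.submatrix ρ π ≠ 1 := by
    rw [← hsort]
    exact fun h => hne ((Matrix.reindex ρ.symm π.symm).injective h)
  rw [hreindex, hreindex, neg_lt_neg_iff, hsort]
  simpa [Matrix.one_apply] using hds.sum_mul_lt_of_ne_one hv hu hne'
end

section
/- Let M ∈ ℝ^{G×G}, and suppose the linear problem min_{T∈Π_G} ⟨M, T⟩ admits a unique optimal solution T*. For each τ > 0 let T_τ be the unique minimizer of T ↦ ⟨M, T⟩ + τ H(T) over Π_G, where H(T) = Σ_{ij} t_{ij} log t_{ij} (with 0·log 0 = 0). Then T_τ converges to T* as τ → 0⁺ (entrywise, equivalently in any norm on ℝ^{G×G}). -/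
open scoped BigOperators

/-- Entropy `H(T) = Σ_{ij} t_{ij} log t_{ij}` (note `Real.log 0 = 0`, giving `0·log 0 = 0`). -/
noncomputable def matEntropy {G : ℕ} (T : Matrix (Fin G) (Fin G) ℝ) : ℝ :=
  ∑ i, ∑ j, T i j * Real.log (T i j)

/-- Minimizers over a compact set of a continuous objective with a vanishing continuous
regularization converge to the minimizer of the objective, when the latter is unique. -/
theorem tendsto_minimizers_of_vanishing_regularization {X : Type*} [TopologicalSpace X]
    {K : Set X} (hK : IsCompact K) {f h : X → ℝ} (hf : Continuous f) (hh : Continuous h)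
    {a : X} (ha : a ∈ K) (hmin : ∀ x ∈ K, f a ≤ f x) (huniq : ∀ x ∈ K, f x = f a → x = a)
    {u : ℝ → X}
    (hu : ∀ τ : ℝ, 0 < τ → u τ ∈ K ∧ ∀ x ∈ K, f (u τ) + τ * h (u τ) ≤ f x + τ * h x) :
    Filter.Tendsto u (nhdsWithin 0 (Set.Ioi 0)) (nhds a) := by
  obtain ⟨C, hC⟩ := hK.exists_bound_of_continuousOn hh.continuousOn
  have hval : Filter.Tendsto (fun τ => f (u τ)) (nhdsWithin 0 (Set.Ioi 0)) (nhds (f a)) := by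
    have hup : Filter.Tendsto (fun τ : ℝ => f a + τ * (2 * C)) (nhdsWithin 0 (Set.Ioi 0))
        (nhds (f a)) := by
      have hcont : Continuous fun τ : ℝ => f a + τ * (2 * C) := by fun_prop
      simpa using (hcont.tendsto 0).mono_left nhdsWithin_le_nhds
    refine tendsto_of_tendsto_of_tendsto_of_le_of_le' tendsto_const_nhds hup ?_ ?_
    · filter_upwards [self_mem_nhdsWithin] with τ hτ
      exact hmin _ (hu τ hτ).1
    · filter_upwards [self_mem_nhdsWithin] with τ hτ
      have hτ' : 0 < τ := hτ
      have hle := (hu τ hτ).2 a ha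
      have hlow := (abs_le.mp (hC _ (hu τ hτ).1)).1
      have hhigh := (abs_le.mp (hC _ ha)).2
      nlinarith
  refine hK.tendsto_nhds_of_unique_mapClusterPt ?_ ?_
  · filter_upwards [self_mem_nhdsWithin] with τ hτ
    exact (hu τ hτ).1
  · intro y hy hcl
    refine huniq y hy ?_
    have hfy : MapClusterPt (f y) (nhdsWithin 0 (Set.Ioi 0)) (f ∘ u) :=
      hcl.continuousAt_comp hf.continuousAt
    have hne : (nhds (f y) ⊓ nhds (f a)).NeBot := hfy.neBot.mono (inf_le_inf_left _ hval)
    exact eq_of_nhds_neBot hne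

theorem IsDoublyStochastic.le_one {G : ℕ} {T : Matrix (Fin G) (Fin G) ℝ}
    (hT : IsDoublyStochastic T) (i j : Fin G) : T i j ≤ 1 :=
  (Finset.single_le_sum (f := fun j => T i j) (fun j _ => hT.1 i j)
    (Finset.mem_univ j)).trans_eq (hT.2.1 i)

theorem isCompact_setOf_isDoublyStochastic (G : ℕ) :
    IsCompact {T : Matrix (Fin G) (Fin G) ℝ | IsDoublyStochastic T} := by
  have hbox : IsCompact (Set.univ.pi fun _ : Fin G => Set.univ.pi fun _ : Fin G =>
      Set.Icc (0 : ℝ) 1) :=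
    isCompact_univ_pi fun _ => isCompact_univ_pi fun _ => isCompact_Icc
  refine hbox.of_isClosed_subset ?_ fun T hT i _ j _ => ⟨hT.1 i j, hT.le_one i j⟩
  have hentry (i j : Fin G) : Continuous fun T : Fin G → Fin G → ℝ => T i j := by fun_prop
  simp only [IsDoublyStochastic, Set.ofPred_and]
  refine IsClosed.inter ?_ (IsClosed.inter ?_ ?_)
  · simp only [Set.ofPred_forall]
    exact isClosed_iInter fun i => isClosed_iInter fun j =>
      isClosed_le continuous_const (hentry i j)
  · simp only [Set.ofPred_forall]
    exact isClosed_iInter fun i =>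
      isClosed_eq (continuous_finsetSum _ fun j _ => hentry i j) continuous_const
  · simp only [Set.ofPred_forall]
    exact isClosed_iInter fun j =>
      isClosed_eq (continuous_finsetSum _ fun i _ => hentry i j) continuous_const

theorem continuous_mInner {G : ℕ} (M : Matrix (Fin G) (Fin G) ℝ) :
    Continuous (mInner M) :=
  continuous_finsetSum _ fun i _ => continuous_finsetSum _ fun j _ =>
    continuous_const.mul (continuous_id.matrix_elem i j)

theorem continuous_matEntropy {G : ℕ} :
    Continuous (matEntropy : Matrix (Fin G) (Fin G) ℝ → ℝ) :=
  continuous_finsetSum _ fun i _ => continuous_finsetSum _ fun j _ =>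
    Real.continuous_mul_log.comp (continuous_id.matrix_elem i j)

/-- if `min_{T ∈ Π_G} ⟨M, T⟩` has a unique optimal solution `T*` and, for each
`τ > 0`, `T_τ` is the unique minimizer of `T ↦ ⟨M, T⟩ + τ H(T)` over `Π_G`, then
`T_τ → T*` as `τ → 0⁺`. -/
theorem stmt14 {G : ℕ} (M : Matrix (Fin G) (Fin G) ℝ)
    (Tstar : Matrix (Fin G) (Fin G) ℝ)
    (hstar : IsDoublyStochastic Tstar ∧
      ∀ T, IsDoublyStochastic T → mInner M Tstar ≤ mInner M T)
    (hstarUnique : ∀ T, (IsDoublyStochastic T ∧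
      ∀ T', IsDoublyStochastic T' → mInner M T ≤ mInner M T') → T = Tstar)
    (Tau : ℝ → Matrix (Fin G) (Fin G) ℝ)
    (hTau : ∀ τ : ℝ, 0 < τ → IsDoublyStochastic (Tau τ) ∧
      ∀ T', IsDoublyStochastic T' →
        mInner M (Tau τ) + τ * matEntropy (Tau τ) ≤ mInner M T' + τ * matEntropy T') :
    Filter.Tendsto Tau (nhdsWithin 0 (Set.Ioi 0)) (nhds Tstar) := by
  exact tendsto_minimizers_of_vanishing_regularization
    (isCompact_setOf_isDoublyStochastic G) (continuous_mInner M) continuous_matEntropy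
    hstar.1 hstar.2
    (fun T hT heq => hstarUnique T ⟨hT, fun T' hT' => heq.trans_le (hstar.2 T' hT')⟩) hTau
end
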